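/- Let x_1, …, x_n ∈ ℝ^d (n ≥ 1), σ > 0, and let P̂(x) = (1/n) Σ_{j=1}^n (√π σ)^{−d} exp(−‖x − x_j‖²/σ²) be the Gaussian Parzen estimator. Suppose the Gaussian-kernel dictionary is γ-coherent, i.e. exp(−‖x_i − x_j‖²/(2σ²)) ≤ γ for all i ≠ j. Then the estimated quadratic Rényi entropy H₂ = −log ∫_{ℝ^d} P̂(x)² dx satisfies H₂ ≥ (d/2) log(2πσ²) + log n − log(1 + (n−1)γ). -/

import Mathlib

open MeasureTheory Real

lemma aux_pt {d : ℕ} (a b x : EuclideanSpace ℝ (Fin d)) (σ : ℝ) (hσ : 0 < σ) :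
    Real.exp (-‖x - a‖ ^ 2 / σ ^ 2) * Real.exp (-‖x - b‖ ^ 2 / σ ^ 2) =
      Real.exp (-‖a - b‖ ^ 2 / (2 * σ ^ 2)) *
        Real.exp (-(2 / σ ^ 2) * ‖x - (1 / 2 : ℝ) • (a + b)‖ ^ 2) := by
  rw [← Real.exp_add, ← Real.exp_add]
  congr 1
  have h1 := parallelogram_law_with_norm ℝ (x - a) (x - b)
  have e1 : (x - a) + (x - b) = (2 : ℝ) • (x - (1 / 2 : ℝ) • (a + b)) := by
    module
  have e2 : (x - a) - (x - b) = -(a - b) := by module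
  rw [e1, e2, norm_neg, norm_smul] at h1
  norm_num at h1
  have : σ ≠ 0 := hσ.ne'
  field_simp
  norm_num
  linarith

lemma aux_base {d : ℕ} (σ : ℝ) (hσ : 0 < σ) :
    Integrable (fun v : EuclideanSpace ℝ (Fin d) => Real.exp (-(2 / σ ^ 2) * ‖v‖ ^ 2)) := by
  have hb : 0 < 2 / σ ^ 2 := by positivity
  apply Integrable.of_integral_ne_zero
  rw [GaussianFourier.integral_rexp_neg_mul_sq_norm hb]
  positivity

lemma aux_int {d : ℕ} (a b : EuclideanSpace ℝ (Fin d)) (σ : ℝ) (hσ : 0 < σ) :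
    Integrable (fun x : EuclideanSpace ℝ (Fin d) =>
      Real.exp (-‖x - a‖ ^ 2 / σ ^ 2) * Real.exp (-‖x - b‖ ^ 2 / σ ^ 2)) := by
  simp_rw [aux_pt a b _ σ hσ]
  exact ((aux_base σ hσ).comp_sub_right _).const_mul _

lemma aux_integral {d : ℕ} (a b : EuclideanSpace ℝ (Fin d)) (σ : ℝ) (hσ : 0 < σ) :
    ∫ x : EuclideanSpace ℝ (Fin d),
      Real.exp (-‖x - a‖ ^ 2 / σ ^ 2) * Real.exp (-‖x - b‖ ^ 2 / σ ^ 2) =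
    Real.exp (-‖a - b‖ ^ 2 / (2 * σ ^ 2)) * (π / (2 / σ ^ 2)) ^ ((d : ℝ) / 2) := by
  have hb : 0 < 2 / σ ^ 2 := by positivity
  simp_rw [aux_pt a b _ σ hσ]
  rw [integral_const_mul, integral_sub_right_eq_self
    (fun v : EuclideanSpace ℝ (Fin d) => Real.exp (-(2 / σ ^ 2) * ‖v‖ ^ 2)),
    GaussianFourier.integral_rexp_neg_mul_sq_norm hb]
  simp

lemma aux_total {d n : ℕ} (X : Fin n → EuclideanSpace ℝ (Fin d)) (σ : ℝ) (hσ : 0 < σ) :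
    (∫ x : EuclideanSpace ℝ (Fin d),
        ((1 / (n : ℝ)) * ∑ j, ((Real.sqrt π * σ) ^ d)⁻¹ *
          Real.exp (-‖x - X j‖ ^ 2 / σ ^ 2)) ^ 2) =
    ((1 / (n : ℝ)) * ((Real.sqrt π * σ) ^ d)⁻¹) ^ 2 * (π / (2 / σ ^ 2)) ^ ((d : ℝ) / 2) *
      ∑ i, ∑ j, Real.exp (-‖X i - X j‖ ^ 2 / (2 * σ ^ 2)) := by
  have h : ∀ x : EuclideanSpace ℝ (Fin d),
      ((1 / (n : ℝ)) * ∑ j, ((Real.sqrt π * σ) ^ d)⁻¹ *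
          Real.exp (-‖x - X j‖ ^ 2 / σ ^ 2)) ^ 2 =
      ((1 / (n : ℝ)) * ((Real.sqrt π * σ) ^ d)⁻¹) ^ 2 * ∑ i, ∑ j,
        Real.exp (-‖x - X i‖ ^ 2 / σ ^ 2) * Real.exp (-‖x - X j‖ ^ 2 / σ ^ 2) := by
    intro x
    rw [← Finset.mul_sum, ← Finset.sum_mul_sum]
    ring
  simp_rw [h]
  rw [integral_const_mul, integral_finsetSum _ (fun i _ => integrable_finsetSum _
    (fun j _ => aux_int (X i) (X j) σ hσ))]
  simp_rw [integral_finsetSum _ (fun j _ => aux_int (X _) (X j) σ hσ),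
    aux_integral _ _ σ hσ, ← Finset.sum_mul]
  ring

lemma aux_sum {d n : ℕ} (X : Fin n → EuclideanSpace ℝ (Fin d)) (σ γ : ℝ)
    (hcoh : ∀ i j, i ≠ j → Real.exp (-‖X i - X j‖ ^ 2 / (2 * σ ^ 2)) ≤ γ) :
    ∑ i, ∑ j, Real.exp (-‖X i - X j‖ ^ 2 / (2 * σ ^ 2)) ≤ n * (1 + ((n : ℝ) - 1) * γ) := by
  have h : ∀ i ∈ (Finset.univ : Finset (Fin n)),
      ∑ j, Real.exp (-‖X i - X j‖ ^ 2 / (2 * σ ^ 2)) ≤ 1 + ((n : ℝ) - 1) * γ := by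
    intro i _
    calc _ ≤ ∑ j, (γ + if i = j then 1 - γ else 0) := by
          apply Finset.sum_le_sum
          intro j _
          by_cases hij : i = j
          · simp [hij]
          · simpa [hij] using hcoh i j hij
      _ = _ := by
          rw [Finset.sum_add_distrib]
          simp
          ring
  refine (Finset.sum_le_sum h).trans (le_of_eq ?_)
  rw [Finset.sum_const, Finset.card_univ, Fintype.card_fin, nsmul_eq_mul]

/-- For a `γ`-coherent Gaussian-kernel dictionary, the estimated quadratic Rényi entropy is
lower-bounded by `(d/2) log(2πσ²) + log n − log(1 + (n−1)γ)`. -/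
theorem quadratic_entropy_lower_bound_coherent (d n : ℕ) (hn : 1 ≤ n)
    (X : Fin n → EuclideanSpace ℝ (Fin d)) (σ γ : ℝ) (hσ : 0 < σ) (hγ : 0 ≤ γ)
    (hcoh : ∀ i j, i ≠ j → Real.exp (-‖X i - X j‖ ^ 2 / (2 * σ ^ 2)) ≤ γ) :
    (d : ℝ) / 2 * Real.log (2 * π * σ ^ 2) + Real.log n
        - Real.log (1 + ((n : ℝ) - 1) * γ) ≤
      -Real.log (∫ x : EuclideanSpace ℝ (Fin d),
        ((1 / (n : ℝ)) * ∑ j, ((Real.sqrt π * σ) ^ d)⁻¹ *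
          Real.exp (-‖x - X j‖ ^ 2 / σ ^ 2)) ^ 2) := by
  have hn0 : (0 : ℝ) < n := by exact_mod_cast hn
  have hn1 : (1 : ℝ) ≤ n := by exact_mod_cast hn
  have hA : 0 < 1 + ((n : ℝ) - 1) * γ := by
    have := mul_nonneg (sub_nonneg.2 hn1) hγ
    linarith
  have hS := aux_sum X σ γ hcoh
  have hpi := Real.pi_pos
  have : Nonempty (Fin n) := ⟨⟨0, hn⟩⟩
  have hS0 : 0 < ∑ i, ∑ j, Real.exp (-‖X i - X j‖ ^ 2 / (2 * σ ^ 2)) :=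
    Finset.sum_pos (fun i _ => Finset.sum_pos (fun j _ => Real.exp_pos _)
      Finset.univ_nonempty) Finset.univ_nonempty
  rw [aux_total X σ hσ]
  have hlog := Real.log_le_log hS0 hS
  rw [Real.log_mul hn0.ne' hA.ne'] at hlog
  have hr : 0 < (π / (2 / σ ^ 2)) ^ ((d : ℝ) / 2) := by positivity
  have l1 : Real.log (2 * π * σ ^ 2) = Real.log 2 + Real.log π + 2 * Real.log σ := by
    rw [Real.log_mul (by positivity) (by positivity), Real.log_mul (by norm_num) hpi.ne',
      Real.log_pow]
    norm_num
  have l2 : Real.log (π / (2 / σ ^ 2)) = Real.log π - Real.log 2 + 2 * Real.log σ := by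
    rw [Real.log_div hpi.ne' (by positivity), Real.log_div (by norm_num) (by positivity),
      Real.log_pow]
    push_cast
    ring
  have l3 : Real.log (1 / (n : ℝ) * ((Real.sqrt π * σ) ^ d)⁻¹) =
      -Real.log n - d * (Real.log π / 2 + Real.log σ) := by
    rw [Real.log_mul (by positivity) (by positivity), one_div, Real.log_inv, Real.log_inv,
      Real.log_pow, Real.log_mul (by positivity) hσ.ne', Real.log_sqrt hpi.le]
    ring
  rw [Real.log_mul (by positivity) hS0.ne', Real.log_mul (by positivity) hr.ne',
    Real.log_rpow (by positivity), Real.log_pow, l1, l2, l3]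
  push_cast
  linarith
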